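/- arXiv:gr-qc/0605072 — 2 statements merged into one kernel-verified Lean document; each statement's English description precedes it below -/
import Mathlib

section
/- Let S ⊆ ℝ × ℕ be a finite set, a : S → ℂ, and δ ∈ ℝ such that p ≥ −δ for every (p,l) ∈ S. If lim_{x→0+} x^{−δ} · Σ_{(p,l)∈S} a(p,l) · x^{−p} (log x)^l = 0, then a(p,l) = 0 for every (p,l) ∈ S. Consequently, the coefficients in an asymptotic expansion of the form f(x) ~ Σ_{p,l} a(p,l) x^{−p}(log x)^l modulo terms vanishing faster than x^δ are uniquely determined by f. -/
open Filter Set Asymptotics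

/-- Functions that are pairwise strictly ordered by growth, none of which decays, are linearly
independent modulo functions tending to zero. -/
theorem eq_zero_of_sum_mul_isLittleO_one {ι α β : Type*} [LinearOrder β] {F : Filter α} [F.NeBot]
    (f : ι → β) (hf : Function.Injective f) (g : ι → α → ℂ) (c : ι → ℂ) (s : Finset ι)
    (hlt : ∀ i ∈ s, ∀ j ∈ s, f i < f j → g i =o[F] g j)
    (hone : ∀ i ∈ s, (fun _ ↦ (1 : ℂ)) =O[F] g i)
    (hsum : (fun x ↦ ∑ i ∈ s, c i * g i x) =o[F] fun _ ↦ (1 : ℂ)) :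
    ∀ i ∈ s, c i = 0 := by
  classical
  induction s using Finset.induction_on_max_value f with
  | empty => simp
  | insert m s hm hmax ih =>
    simp only [Finset.sum_insert hm] at hsum
    have hlow : (fun x ↦ ∑ i ∈ s, c i * g i x) =o[F] g m := by
      refine IsLittleO.fun_sum fun i hi ↦ IsLittleO.const_mul_left ?_ _
      refine hlt i (Finset.mem_insert_of_mem hi) m (Finset.mem_insert_self m s) ?_
      exact (hmax i hi).lt_of_ne fun h ↦ hm (hf h ▸ hi)
    have htop : (fun x ↦ c m * g m x) =o[F] g m := by
      refine ((hsum.trans_isBigO (hone m (Finset.mem_insert_self m s))).sub hlow).congr_left ?_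
      intro x
      ring
    have hcm : c m = 0 := by
      by_contra hne
      have hself : g m =o[F] g m := (isLittleO_const_mul_left_iff hne).1 htop
      refine isLittleO_irrefl (Eventually.frequently ?_) hself
      filter_upwards [(hone m (Finset.mem_insert_self m s)).eq_zero_imp] with x hx h0
      exact one_ne_zero (hx h0)
    have hs := ih (fun i hi j hj ↦ hlt i (Finset.mem_insert_of_mem hi) j
      (Finset.mem_insert_of_mem hj)) (fun i hi ↦ hone i (Finset.mem_insert_of_mem hi))
      (by simpa [hcm] using hsum)
    intro i hi
    rcases Finset.mem_insert.1 hi with rfl | hi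
    · exact hcm
    · exact hs i hi

theorem one_isBigO_exp_mul_pow_atTop {q : ℝ} (hq : 0 ≤ q) (l : ℕ) :
    (fun _ ↦ (1 : ℝ)) =O[atTop] fun t : ℝ ↦ Real.exp (q * t) * t ^ l := by
  refine IsBigO.of_bound 1 ?_
  filter_upwards [eventually_ge_atTop 1] with t ht
  have hexp : 1 ≤ Real.exp (q * t) := Real.one_le_exp (by positivity)
  have hpow : 1 ≤ t ^ l := one_le_pow₀ ht
  rw [Real.norm_of_nonneg zero_le_one, Real.norm_of_nonneg (by positivity), one_mul]
  exact one_le_mul_of_one_le_of_one_le hexp hpow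

theorem exp_mul_pow_isLittleO_exp_mul_pow_atTop {q q' : ℝ} {l l' : ℕ}
    (h : toLex (q, l) < toLex (q', l')) :
    (fun t : ℝ ↦ Real.exp (q * t) * t ^ l) =o[atTop] fun t ↦ Real.exp (q' * t) * t ^ l' := by
  rcases Prod.Lex.toLex_lt_toLex.1 h with hq | ⟨hq, hl⟩
  · have hexp : (fun t : ℝ ↦ t ^ l) =o[atTop] fun t ↦ Real.exp ((q' - q) * t) * t ^ l' := by
      have hpow : (fun _ ↦ (1 : ℝ)) =O[atTop] fun t : ℝ ↦ t ^ l' := by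
        simpa using one_isBigO_exp_mul_pow_atTop le_rfl l'
      simpa using (isLittleO_pow_exp_pos_mul_atTop (k := l) (sub_pos.2 hq)).mul_isBigO hpow
    refine ((isBigO_refl (fun t ↦ Real.exp (q * t)) atTop).mul_isLittleO hexp).congr_right ?_
    intro t
    rw [← mul_assoc, ← Real.exp_add]
    ring_nf
  · obtain rfl : q = q' := hq
    exact (isBigO_refl _ _).mul_isLittleO (isLittleO_pow_pow_atTop_of_lt hl)

/-- Let `S ⊆ ℝ × ℕ` be a finite set, `a : S → ℂ`, and `δ ∈ ℝ` such
that `p ≥ −δ` for every `(p,l) ∈ S`.  If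
`lim_{x→0+} x^{−δ} · Σ_{(p,l)∈S} a(p,l)·x^{−p}(log x)^l = 0`
(here `x^{−p} := exp (−p · log x)`), then `a(p,l) = 0` for every `(p,l) ∈ S`.
Consequently, the coefficients in an asymptotic expansion of the form
`f(x) ~ Σ_{p,l} a(p,l) x^{−p}(log x)^l` modulo terms vanishing faster than `x^δ` are
uniquely determined by `f`. -/
theorem asymptotic_pow_log_linear_independent
    (S : Finset (ℝ × ℕ)) (a : ℝ × ℕ → ℂ) (δ : ℝ)
    (hge : ∀ pl ∈ S, -δ ≤ pl.1)
    (hlim : Tendsto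
      (fun x : ℝ => (Real.exp (-δ * Real.log x) : ℂ) *
        ∑ pl ∈ S,
          a pl * Complex.exp (-(pl.1 : ℂ) * (Real.log x : ℂ)) * (Real.log x : ℂ) ^ pl.2)
      (nhdsWithin 0 (Ioi 0)) (nhds 0)) :
    ∀ pl ∈ S, a pl = 0 := by
  have hlog : Tendsto (fun x : ℝ ↦ -Real.log x) (nhdsWithin 0 (Ioi 0)) atTop :=
    tendsto_neg_atBot_atTop.comp Real.tendsto_log_nhdsGT_zero
  have hnorm : ∀ pl : ℝ × ℕ, ∀ᶠ x in nhdsWithin (0 : ℝ) (Ioi 0),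
      ‖Real.exp ((δ + pl.1) * -Real.log x) * (-Real.log x) ^ pl.2‖ =
        ‖(Real.exp (-δ * Real.log x) : ℂ) *
          (Complex.exp (-(pl.1 : ℂ) * (Real.log x : ℂ)) * (Real.log x : ℂ) ^ pl.2)‖ := by
    refine fun pl ↦ Eventually.of_forall fun x ↦ ?_
    have hcast : Complex.exp (-(pl.1 : ℂ) * (Real.log x : ℂ)) =
        (Real.exp (-pl.1 * Real.log x) : ℂ) := by
      push_cast
      rfl
    have hadd : (δ + pl.1) * -Real.log x = -δ * Real.log x + -pl.1 * Real.log x := by ring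
    rw [hcast, hadd, Real.exp_add]
    simp only [norm_mul, norm_pow, norm_neg, Complex.norm_real, mul_assoc]
  refine eq_zero_of_sum_mul_isLittleO_one (F := nhdsWithin (0 : ℝ) (Ioi 0)) toLex
    toLex.injective
    (fun pl x ↦ (Real.exp (-δ * Real.log x) : ℂ) *
      (Complex.exp (-(pl.1 : ℂ) * (Real.log x : ℂ)) * (Real.log x : ℂ) ^ pl.2))
    a S ?_ ?_ ?_
  · rintro ⟨p, l⟩ - ⟨p', l'⟩ - hlt
    have hshift : toLex (δ + p, l) < toLex (δ + p', l') := by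
      simpa [Prod.Lex.toLex_lt_toLex] using hlt
    have hreal := (exp_mul_pow_isLittleO_exp_mul_pow_atTop hshift).comp_tendsto hlog
    exact (hreal.norm_norm.congr' (hnorm (p, l)) (hnorm (p', l'))).of_norm_norm
  · intro pl hpl
    have hreal := (one_isBigO_exp_mul_pow_atTop (q := δ + pl.1)
      (by linarith [hge pl hpl]) pl.2).comp_tendsto hlog
    refine (hreal.norm_norm.congr' ?_ (hnorm pl)).of_norm_norm
    exact Eventually.of_forall fun x ↦ by simp
  · rw [isLittleO_one_iff]
    refine hlim.congr fun x ↦ ?_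
    rw [Finset.mul_sum]
    exact Finset.sum_congr rfl fun pl _ ↦ by ring
end

section
/- Let L, k, r be positive integers with L ≤ 4, let k₁, …, k_r be positive integers with k₁ + ⋯ + k_r ≤ k, and let δ ≥ 0 be a real number. Then for every integer N ≥ 1, Σ over all r-tuples of integers (α₁,…,α_r) with 1 ≤ α₁ < α₂ < ⋯ < α_r ≤ N − 1 of the quantity (2 : ℝ)^{ −N(δ + 4k + 1) + L·(k₁α₁ + ⋯ + k_rα_r) } is at most (2 : ℝ)^{ −N(δ + 1) }. -/
theorem sum_fin_two_rpow_sub_le_one (N : ℕ) :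
    ∑ a : Fin N, (2 : ℝ) ^ (((a : ℕ) : ℝ) - N) ≤ 1 := by
  have h (a : ℕ) : (2 : ℝ) ^ ((a : ℝ) - N) = 2 ^ a / 2 ^ N := by
    rw [Real.rpow_sub two_pos, Real.rpow_natCast, Real.rpow_natCast]
  simp only [h]
  rw [Fin.sum_univ_eq_sum_range (fun a => (2 : ℝ) ^ a / 2 ^ N), ← Finset.sum_div,
    div_le_one (by positivity), geom_sum_eq (by norm_num)]
  norm_num


/-- Let `L, k, r` be positive integers with `L ≤ 4`, let
`k₁, …, k_r` be positive integers with `k₁ + ⋯ + k_r ≤ k`, and let `δ ≥ 0` be real.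
Then for every integer `N ≥ 1`, the sum over all `r`-tuples of integers
`(α₁,…,α_r)` with `1 ≤ α₁ < α₂ < ⋯ < α_r ≤ N − 1` (equivalently, strictly monotone
tuples valued in `{1,…,N−1} ⊆ Fin N`) of
`2^{−N(δ+4k+1) + L(k₁α₁ + ⋯ + k_rα_r)}` is at most `2^{−N(δ+1)}`
(real powers of `2`). -/
theorem dyadic_slice_geometric_estimate
    (L k r : ℕ) (hL : 1 ≤ L) (hL4 : L ≤ 4) (hk : 1 ≤ k) (hr : 1 ≤ r)
    (ks : Fin r → ℕ) (hks : ∀ i, 1 ≤ ks i) (hsum : ∑ i, ks i ≤ k)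
    (δ : ℝ) (hδ : 0 ≤ δ) (N : ℕ) (hN : 1 ≤ N) :
    ∑ α ∈ Finset.univ.filter
        (fun α : Fin r → Fin N =>
          (∀ i j : Fin r, i < j → α i < α j) ∧ ∀ i, 1 ≤ (α i : ℕ)),
      (2 : ℝ) ^ (-(N : ℝ) * (δ + 4 * (k : ℝ) + 1)
          + (L : ℝ) * ∑ i, (ks i : ℝ) * ((α i : ℕ) : ℝ))
      ≤ (2 : ℝ) ^ (-(N : ℝ) * (δ + 1)) := by
  have exponent_le (α : Fin r → Fin N) :
      -(N : ℝ) * (δ + 4 * (k : ℝ) + 1) + (L : ℝ) * ∑ i, (ks i : ℝ) * ((α i : ℕ) : ℝ)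
        ≤ -(N : ℝ) * (δ + 1) + ∑ i, (((α i : ℕ) : ℝ) - N) := by
    have hL4' : (L : ℝ) ≤ 4 := by exact_mod_cast hL4
    have hsum' : ∑ i, (ks i : ℝ) ≤ k := by exact_mod_cast hsum
    have h₁ : (L : ℝ) * ∑ i, (ks i : ℝ) * ((α i : ℕ) : ℝ)
        ≤ 4 * ∑ i, (ks i : ℝ) * ((α i : ℕ) : ℝ) := by gcongr
    have h₂ : (N : ℝ) * ∑ i, (ks i : ℝ) ≤ N * k := by gcongr
    have h₃ : ∑ i, 4 * ((ks i : ℝ) * (((α i : ℕ) : ℝ) - N)) ≤ ∑ i, (((α i : ℕ) : ℝ) - N) := by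
      refine Finset.sum_le_sum fun i _ => ?_
      have hα : ((α i : ℕ) : ℝ) ≤ N := by exact_mod_cast (α i).isLt.le
      have hki : (1 : ℝ) ≤ ks i := by exact_mod_cast hks i
      nlinarith
    rw [← Finset.mul_sum] at h₃
    simp only [mul_sub, Finset.sum_sub_distrib, ← Finset.sum_mul] at h₃ ⊢
    linarith
  calc
    _ ≤ ∑ α : Fin r → Fin N,
          (2 : ℝ) ^ (-(N : ℝ) * (δ + 1)) * ∏ i, (2 : ℝ) ^ (((α i : ℕ) : ℝ) - N) := by
      refine (Finset.sum_le_sum fun α _ => ?_).trans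
        (Finset.sum_le_sum_of_subset_of_nonneg (Finset.filter_subset _ _)
          fun α _ _ => by positivity)
      rw [← Real.rpow_sum_of_pos two_pos, ← Real.rpow_add two_pos]
      exact Real.rpow_le_rpow_of_exponent_le one_le_two (exponent_le α)
    _ = (2 : ℝ) ^ (-(N : ℝ) * (δ + 1)) *
          ∏ _i : Fin r, ∑ a : Fin N, (2 : ℝ) ^ (((a : ℕ) : ℝ) - N) := by
      rw [← Finset.mul_sum, Fintype.prod_sum]
    _ ≤ (2 : ℝ) ^ (-(N : ℝ) * (δ + 1)) := by
      refine mul_le_of_le_one_right (by positivity) (Finset.prod_le_one (fun _ _ => ?_)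
        fun _ _ => sum_fin_two_rpow_sub_le_one N)
      positivity
end
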